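/- arXiv:2309.15355 — 3 statements merged into one kernel-verified Lean document; each statement's English description precedes it below -/
import Mathlib

section
/- Let X be an n×p real matrix, p ≥ 2, and let β ∈ ℝ^p have at most s nonzero coordinates. Let σ > 0, λ = √(2·log p/n), let s₀ be the essential sparsity of β, and let T₀ be a set of indices of the s₀ largest coordinates of β in absolute value. Then ‖β_{T₀^c}‖₂ ≤ λσ·√s₀ and ‖X(β − β_{T₀})‖₂/√n ≤ √Λ_max(s − s₀)·λσ·√s₀. -/
open Finset Matrix Real
open scoped BigOperators Classical

noncomputable section

namespace ThreshLasso

/-- ℓ₂ norm of a finite real vector. -/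
def l2 {m : ℕ} (v : Fin m → ℝ) : ℝ := Real.sqrt (∑ i, (v i) ^ 2)

/-- ℓ₁ norm of a finite real vector. -/
def l1 {m : ℕ} (v : Fin m → ℝ) : ℝ := ∑ i, |v i|

/-- Restriction of a vector to a set of coordinates (zero outside). -/
def restr {p : ℕ} (v : Fin p → ℝ) (T : Finset (Fin p)) : Fin p → ℝ :=
  fun j => if j ∈ T then v j else 0

/-- Support of a vector, as a `Finset`. -/
def supp {p : ℕ} (v : Fin p → ℝ) : Finset (Fin p) :=
  Finset.univ.filter fun j => v j ≠ 0

/-- `L` is the minimal `m`-sparse eigenvalue `Λ_min(m)` of `X`: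
the least value of `‖Xv‖₂²/(n‖v‖₂²)` over nonzero `v` with at most `m`
nonzero coordinates. -/
def IsLambdaMin {n p : ℕ} (X : Matrix (Fin n) (Fin p) ℝ) (m : ℕ) (L : ℝ) : Prop :=
  IsLeast {r : ℝ | ∃ v : Fin p → ℝ, v ≠ 0 ∧ (supp v).card ≤ m ∧
    r = (l2 (X.mulVec v)) ^ 2 / (n * (l2 v) ^ 2)} L

/-- `L` is the maximal `m`-sparse eigenvalue `Λ_max(m)` of `X`
(with the convention `Λ_max(0) = 0`, implemented by inserting `0` in the set,
which does not change the maximum when `m ≥ 1`). -/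
def IsLambdaMax {n p : ℕ} (X : Matrix (Fin n) (Fin p) ℝ) (m : ℕ) (L : ℝ) : Prop :=
  IsGreatest (insert (0 : ℝ) {r : ℝ | ∃ v : Fin p → ℝ, v ≠ 0 ∧ (supp v).card ≤ m ∧
    r = (l2 (X.mulVec v)) ^ 2 / (n * (l2 v) ^ 2)}) L

/-- `θ` is the restricted orthogonality constant `θ_{m,m'}` of `X`: the smallest
nonnegative `t` such that `|⟨Xu, Xu'⟩|/n ≤ t‖u‖₂‖u'‖₂` for all `u, u'` supported
on disjoint sets of cardinality at most `m`, `m'` respectively. -/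
def IsTheta {n p : ℕ} (X : Matrix (Fin n) (Fin p) ℝ) (m m' : ℕ) (θ : ℝ) : Prop :=
  IsLeast {t : ℝ | 0 ≤ t ∧ ∀ (u u' : Fin p → ℝ) (T T' : Finset (Fin p)),
    Disjoint T T' → T.card ≤ m → T'.card ≤ m' →
    (∀ j, j ∉ T → u j = 0) → (∀ j, j ∉ T' → u' j = 0) →
    |∑ i, (X.mulVec u i) * (X.mulVec u' i)| / n ≤ t * (l2 u * l2 u')} θ

/-- Restricted eigenvalue condition `RE(s₀, k₀, X)` with constant `K`. -/
def RECond {n p : ℕ} (X : Matrix (Fin n) (Fin p) ℝ) (s₀ : ℕ) (k₀ K : ℝ) : Prop :=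
  0 < K ∧ ∀ (v : Fin p → ℝ) (J : Finset (Fin p)), J.card ≤ s₀ →
    l1 (restr v Jᶜ) ≤ k₀ * l1 (restr v J) →
    l2 (restr v J) / K ≤ l2 (X.mulVec v) / Real.sqrt n

/-- `s₀` is the essential sparsity of `β`: the smallest nonnegative integer `m`
with `∑ᵢ min(βᵢ², λ²σ²) ≤ m λ²σ²`. -/
def EssSparsity {p : ℕ} (β : Fin p → ℝ) (lam σ : ℝ) (s₀ : ℕ) : Prop :=
  IsLeast {m : ℕ | ∑ i, min ((β i) ^ 2) (lam ^ 2 * σ ^ 2) ≤ (m : ℝ) * (lam ^ 2 * σ ^ 2)} s₀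

/-- `T₀` is a set of indices of the `s₀` largest coordinates of `β` in absolute value. -/
def TopSet {p : ℕ} (β : Fin p → ℝ) (s₀ : ℕ) (T₀ : Finset (Fin p)) : Prop :=
  T₀.card = s₀ ∧ ∀ i ∈ T₀, ∀ j, j ∉ T₀ → |β j| ≤ |β i|

/-- `T₁` is a set of indices of the `s₀` largest coordinates of `h` in absolute
value outside `T₀`. -/
def TopSetOutside {p : ℕ} (h : Fin p → ℝ) (s₀ : ℕ) (T₀ T₁ : Finset (Fin p)) : Prop :=
  T₁.card = s₀ ∧ Disjoint T₀ T₁ ∧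
    ∀ i ∈ T₁, ∀ j, j ∉ T₀ → j ∉ T₁ → |h j| ≤ |h i|

/-- `b` is a Lasso minimizer with penalty `lamn` for data `(X, Y)`. -/
def IsLassoSol {n p : ℕ} (X : Matrix (Fin n) (Fin p) ℝ) (Y : Fin n → ℝ)
    (lamn : ℝ) (b : Fin p → ℝ) : Prop :=
  ∀ b' : Fin p → ℝ,
    1 / (2 * n) * (l2 (Y - X.mulVec b)) ^ 2 + lamn * l1 b ≤
    1 / (2 * n) * (l2 (Y - X.mulVec b')) ^ 2 + lamn * l1 b'

/-- Submatrix of the columns of `X` indexed by `I`. -/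
def colSub {n p : ℕ} (X : Matrix (Fin n) (Fin p) ℝ) (I : Finset (Fin p)) :
    Matrix (Fin n) {j // j ∈ I} ℝ :=
  Matrix.of fun i j => X i j.1

/-- The Gram matrix `X_Iᵀ X_I` is invertible. -/
def GramInvertible {n p : ℕ} (X : Matrix (Fin n) (Fin p) ℝ) (I : Finset (Fin p)) : Prop :=
  IsUnit ((colSub X I)ᵀ * colSub X I).det

/-- The OLS refit of `Y` on the columns of `X` indexed by `I`:
`(X_Iᵀ X_I)⁻¹ X_Iᵀ Y` on `I`, and `0` off `I`. -/
def olsRefit {n p : ℕ} (X : Matrix (Fin n) (Fin p) ℝ) (Y : Fin n → ℝ)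
    (I : Finset (Fin p)) : Fin p → ℝ :=
  fun j => if h : j ∈ I then
    (((colSub X I)ᵀ * colSub X I)⁻¹).mulVec ((colSub X I)ᵀ.mulVec Y) ⟨j, h⟩
  else 0


/-- Outside the top `s₀` coordinates, every coordinate lies below the truncation level. -/
lemma EssSparsity.sq_le_of_notMem {p s₀ : ℕ} {β : Fin p → ℝ} {lam σ : ℝ}
    (hess : EssSparsity β lam σ s₀) (hc : 0 < lam ^ 2 * σ ^ 2) {T₀ : Finset (Fin p)}
    (hT₀ : TopSet β s₀ T₀) {j : Fin p} (hj : j ∉ T₀) : (β j) ^ 2 ≤ lam ^ 2 * σ ^ 2 := by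
  by_contra! hlt
  have hbig : ∀ i ∈ insert j T₀,
      lam ^ 2 * σ ^ 2 ≤ min ((β i) ^ 2) (lam ^ 2 * σ ^ 2) := by
    intro i hi
    refine le_min ?_ le_rfl
    rcases Finset.mem_insert.1 hi with rfl | hi
    · exact hlt.le
    · exact hlt.le.trans (sq_le_sq.2 (hT₀.2 i hi j hj))
  have hcard := Finset.card_nsmul_le_sum _ _ _ hbig
  rw [Finset.card_insert_of_notMem hj, hT₀.1, nsmul_eq_mul] at hcard
  have hsub : ∑ i ∈ insert j T₀, min ((β i) ^ 2) (lam ^ 2 * σ ^ 2) ≤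
      ∑ i, min ((β i) ^ 2) (lam ^ 2 * σ ^ 2) :=
    Finset.sum_le_sum_of_subset_of_nonneg (Finset.subset_univ _)
      fun i _ _ => le_min (sq_nonneg _) hc.le
  have hle : ∑ i, min ((β i) ^ 2) (lam ^ 2 * σ ^ 2) ≤ (s₀ : ℝ) * (lam ^ 2 * σ ^ 2) := hess.1
  push_cast at hcard
  linarith

lemma l2_nonneg {m : ℕ} (v : Fin m → ℝ) : 0 ≤ l2 v :=
  Real.sqrt_nonneg _

lemma sub_restr {p : ℕ} (v : Fin p → ℝ) (T : Finset (Fin p)) :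
    v - restr v T = restr v Tᶜ := by
  ext j
  by_cases h : j ∈ T <;> simp [restr, h]

/-- The tail of `β` off its top `s₀` coordinates has squared `ℓ₂` norm at most `s₀ λ²σ²`. -/
lemma EssSparsity.sum_sq_restr_compl_le {p s₀ : ℕ} {β : Fin p → ℝ} {lam σ : ℝ}
    (hess : EssSparsity β lam σ s₀) (hc : 0 < lam ^ 2 * σ ^ 2) {T₀ : Finset (Fin p)}
    (hT₀ : TopSet β s₀ T₀) :
    ∑ i, (restr β T₀ᶜ i) ^ 2 ≤ (s₀ : ℝ) * (lam ^ 2 * σ ^ 2) := by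
  refine le_trans (Finset.sum_le_sum fun i _ => ?_) hess.1
  by_cases hi : i ∈ T₀
  · simpa [restr, hi] using le_min (sq_nonneg (β i)) hc.le
  · simpa [restr, hi, ← mul_pow] using hess.sq_le_of_notMem hc hT₀ hi

lemma TopSet.restr_compl_eq_zero_or_card_supp_le {p s s₀ : ℕ} {β : Fin p → ℝ}
    {T₀ : Finset (Fin p)} (hT₀ : TopSet β s₀ T₀) (hβ : (supp β).card ≤ s) :
    restr β T₀ᶜ = 0 ∨ (supp (restr β T₀ᶜ)).card ≤ s - s₀ := by
  by_cases hsub : T₀ ⊆ supp β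
  · right
    have hsupp : supp (restr β T₀ᶜ) = supp β \ T₀ := by
      ext j
      by_cases h : j ∈ T₀ <;> simp [restr, supp, h]
    rw [hsupp, Finset.card_sdiff_of_subset hsub, hT₀.1]
    omega
  · left
    obtain ⟨i, hi, hi0⟩ := Finset.not_subset.1 hsub
    have hzero : β i = 0 := by simpa [supp] using hi0
    ext j
    by_cases h : j ∈ T₀
    · simp [restr, h]
    · simpa [restr, h, hzero] using hT₀.2 i hi j h

lemma IsLambdaMax.nonneg {n p m : ℕ} {X : Matrix (Fin n) (Fin p) ℝ} {L : ℝ}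
    (hL : IsLambdaMax X m L) : 0 ≤ L :=
  hL.2 (Set.mem_insert _ _)

lemma IsLambdaMax.l2_mulVec_div_le {n p m : ℕ} {X : Matrix (Fin n) (Fin p) ℝ} {L : ℝ}
    (hL : IsLambdaMax X m L) {v : Fin p → ℝ} (hv : v = 0 ∨ (supp v).card ≤ m) :
    l2 (X.mulVec v) / Real.sqrt n ≤ Real.sqrt L * l2 v := by
  by_cases h0 : v = 0
  · subst h0
    simp [l2]
  rcases n.eq_zero_or_pos with rfl | hn
  · simpa using mul_nonneg (Real.sqrt_nonneg L) (l2_nonneg v)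
  have hvpos : 0 < l2 v := by
    obtain ⟨j, hj⟩ := Function.ne_iff.1 h0
    exact Real.sqrt_pos.2 (Finset.sum_pos' (fun i _ => sq_nonneg _)
      ⟨j, Finset.mem_univ j, sq_pos_of_ne_zero hj⟩)
  have hle : (l2 (X.mulVec v)) ^ 2 / (n * (l2 v) ^ 2) ≤ L :=
    hL.2 (Set.mem_insert_of_mem _ ⟨v, h0, hv.resolve_left h0, rfl⟩)
  have hn' : (0 : ℝ) < n := Nat.cast_pos.2 hn
  rw [div_le_iff₀ (by positivity)] at hle
  rw [div_le_iff₀ (Real.sqrt_pos.2 hn')]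
  refine (pow_le_pow_iff_left₀ (l2_nonneg _) (by positivity) two_ne_zero).1 ?_
  rw [mul_pow, mul_pow, Real.sq_sqrt hL.nonneg, Real.sq_sqrt hn'.le]
  linarith

/-- prediction error using `β_{T₀}` (Lemma on the bias). -/
theorem statement_9
    (n p s s₀ : ℕ) (hn : 0 < n) (hp : 2 ≤ p)
    (X : Matrix (Fin n) (Fin p) ℝ)
    (β : Fin p → ℝ) (hβ : (supp β).card ≤ s)
    (σ lam : ℝ) (hσ : 0 < σ) (hlam : lam = Real.sqrt (2 * Real.log p / n))
    (hess : EssSparsity β lam σ s₀)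
    (T₀ : Finset (Fin p)) (hT₀ : TopSet β s₀ T₀)
    (Lmax : ℝ) (hLmax : IsLambdaMax X (s - s₀) Lmax) :
    l2 (restr β T₀ᶜ) ≤ lam * σ * Real.sqrt s₀ ∧
    l2 (X.mulVec (β - restr β T₀)) / Real.sqrt n ≤
      Real.sqrt Lmax * lam * σ * Real.sqrt s₀ := by
  have hn' : (0 : ℝ) < n := Nat.cast_pos.2 hn
  have hlog : 0 < Real.log p := Real.log_pos (by exact_mod_cast hp)
  have hlam_pos : 0 < lam := hlam ▸ Real.sqrt_pos.2 (by positivity)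
  have htail : l2 (restr β T₀ᶜ) ≤ lam * σ * Real.sqrt s₀ := by
    refine Real.sqrt_le_iff.2 ⟨by positivity, ?_⟩
    refine (hess.sum_sq_restr_compl_le (by positivity) hT₀).trans_eq ?_
    rw [mul_pow, mul_pow, Real.sq_sqrt (Nat.cast_nonneg _)]
    ring
  refine ⟨htail, ?_⟩
  rw [sub_restr]
  calc l2 (X.mulVec (restr β T₀ᶜ)) / Real.sqrt n
      ≤ Real.sqrt Lmax * l2 (restr β T₀ᶜ) :=
        hLmax.l2_mulVec_div_le (hT₀.restr_compl_eq_zero_or_card_supp_le hβ)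
    _ ≤ Real.sqrt Lmax * (lam * σ * Real.sqrt s₀) := by gcongr
    _ = Real.sqrt Lmax * lam * σ * Real.sqrt s₀ := by ring

end ThreshLasso
end
end

section
/- Let p ≥ 2, n ≥ 1, let β ∈ ℝ^p satisfy |β_1| ≥ |β_2| ≥ … ≥ |β_p|, let σ > 0, λ = √(2·log p/n), let s₀ ≥ 1 be the essential sparsity of β with 2s₀ ≤ p, T₀ = {1,…,s₀}, A₀ = {j : |β_j| > λσ}, and a₀ = |A₀|. Let β_init ∈ ℝ^p, h = β_init − β_{T₀}, let T₁ be a set of s₀ indices of the largest |h_j| over j ∉ T₀, and T₀₁ = T₀ ∪ T₁. Suppose ‖h_{T₀₁}‖₂ ≤ D₀·λσ·√s₀ and ‖h_{T₀^c}‖₁ ≤ D₁·λσ·s₀ for some D₀, D₁ > 0, let D̆₀ > D₀ and D̆₁ > D₁, set t₀ = min(D̆₀, D̆₁)·λσ, and assume min_{j∈A₀}|β_j| ≥ D₀·λσ·√s₀ + t₀. Let I = {j : |β_init,j| ≥ t₀} and 𝒟 = {1,…,p} \ I. Then A₀ ⊆ I, I ∩ T₀₁^c = ∅ (hence |I| ≤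 2s₀), and ‖β_𝒟‖₂ ≤ λσ·√(s₀ − a₀). -/
open Finset Matrix Real
open scoped BigOperators Classical

noncomputable section

namespace ThreshLasso

theorem sum_sq_le_of_l2_restr_le {p : ℕ} (v : Fin p → ℝ) (T : Finset (Fin p)) {c : ℝ}
    (hv : l2 (restr v T) ≤ c) : ∑ i ∈ T, (v i) ^ 2 ≤ c ^ 2 := by
  have hsum : ∑ i, (restr v T i) ^ 2 = ∑ i ∈ T, (v i) ^ 2 := by
    simp [restr, ite_pow, Finset.sum_ite_mem]
  unfold l2 at hv
  rw [hsum] at hv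
  exact (Real.sqrt_le_left ((Real.sqrt_nonneg _).trans hv)).1 hv

theorem l1_restr {p : ℕ} (v : Fin p → ℝ) (T : Finset (Fin p)) :
    l1 (restr v T) = ∑ i ∈ T, |v i| := by
  simp [l1, restr, apply_ite abs, Finset.sum_ite_mem]

theorem l2_restr {p : ℕ} (v : Fin p → ℝ) (T : Finset (Fin p)) :
    l2 (restr v T) = Real.sqrt (∑ i ∈ T, (v i) ^ 2) := by
  simp [l2, restr, ite_pow, Finset.sum_ite_mem]

/-- The coordinates of `v` below the level `μ` have squared norm at most `(s - a) μ²`, where `a` is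
the number of coordinates above that level. -/
theorem sum_sq_compl_le {p : ℕ} (v : Fin p → ℝ) {μ : ℝ} (hμ : 0 ≤ μ) {s : ℕ} (A : Finset (Fin p))
    (hA : ∀ j, j ∈ A ↔ μ < |v j|)
    (hs : ∑ i, min ((v i) ^ 2) (μ ^ 2) ≤ (s : ℝ) * μ ^ 2) :
    ∑ i ∈ Aᶜ, (v i) ^ 2 ≤ ((s : ℝ) - A.card) * μ ^ 2 := by
  have hin : ∑ i ∈ A, min ((v i) ^ 2) (μ ^ 2) = A.card * μ ^ 2 := by
    rw [← nsmul_eq_mul, ← Finset.sum_const]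
    refine Finset.sum_congr rfl fun i hi => min_eq_right ?_
    rw [← sq_abs (v i)]
    have := (hA i).1 hi
    gcongr
  have hout : ∑ i ∈ Aᶜ, min ((v i) ^ 2) (μ ^ 2) = ∑ i ∈ Aᶜ, (v i) ^ 2 := by
    refine Finset.sum_congr rfl fun i hi => min_eq_left ?_
    rw [← sq_abs (v i)]
    have : |v i| ≤ μ := not_lt.1 fun hlt => Finset.mem_compl.1 hi ((hA i).2 hlt)
    gcongr
  have := Finset.sum_add_sum_compl A fun i => min ((v i) ^ 2) (μ ^ 2)
  linarith

/-- If `|v|` is nonincreasing, every index of a superlevel set is smaller than its cardinality. -/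
theorem lt_card_of_mem_superlevel {p : ℕ} (v : Fin p → ℝ)
    (hv : ∀ i j : Fin p, i ≤ j → |v j| ≤ |v i|) {μ : ℝ} (A : Finset (Fin p))
    (hA : ∀ j, j ∈ A ↔ μ < |v j|) {j : Fin p} (hj : j ∈ A) : (j : ℕ) < A.card := by
  have hsub : Finset.Iic j ⊆ A := fun i hi =>
    (hA i).2 (((hA j).1 hj).trans_le (hv i j (Finset.mem_Iic.1 hi)))
  have := Finset.card_le_card hsub
  rw [Fin.card_Iic] at this
  omega

/-- A coordinate outside `T₀ ∪ T₁` is at most the average of `|h|` over `T₁`, in the ℓ₁ and in the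
ℓ₂ sense. -/
theorem TopSetOutside.abs_le {p : ℕ} {h : Fin p → ℝ} {s : ℕ} {T₀ T₁ : Finset (Fin p)}
    (hT : TopSetOutside h s T₀ T₁) (hs : 1 ≤ s) {c d : ℝ} (hc : 0 ≤ c)
    (hhead : l2 (restr h (T₀ ∪ T₁)) ≤ c * Real.sqrt s)
    (htail : l1 (restr h T₀ᶜ) ≤ d * s) {j : Fin p} (hj : j ∉ T₀ ∪ T₁) :
    |h j| ≤ c ∧ |h j| ≤ d := by
  obtain ⟨hcard, hdisj, htop⟩ := hT
  rw [Finset.notMem_union] at hj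
  have hs' : (0 : ℝ) < s := by exact_mod_cast hs
  constructor
  · have h1 := sum_sq_le_of_l2_restr_le h _ hhead
    have h2 : (s : ℝ) * |h j| ^ 2 ≤ ∑ i ∈ T₁, (h i) ^ 2 := by
      rw [← hcard, ← nsmul_eq_mul]
      refine Finset.card_nsmul_le_sum _ _ _ fun i hi => ?_
      rw [← sq_abs (h i)]
      have := htop i hi j hj.1 hj.2
      gcongr
    have h3 : ∑ i ∈ T₁, (h i) ^ 2 ≤ ∑ i ∈ T₀ ∪ T₁, (h i) ^ 2 :=
      Finset.sum_le_sum_of_subset_of_nonneg Finset.subset_union_right fun i _ _ => sq_nonneg _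
    rw [mul_pow, Real.sq_sqrt hs'.le] at h1
    refine abs_le_of_sq_le_sq' ?_ hc |>.2
    nlinarith
  · rw [l1_restr] at htail
    have h2 : (s : ℝ) * |h j| ≤ ∑ i ∈ T₁, |h i| := by
      rw [← hcard, ← nsmul_eq_mul]
      exact Finset.card_nsmul_le_sum _ _ _ fun i hi => htop i hi j hj.1 hj.2
    have h3 : ∑ i ∈ T₁, |h i| ≤ ∑ i ∈ T₀ᶜ, |h i| :=
      Finset.sum_le_sum_of_subset_of_nonneg
        (fun i hi => Finset.mem_compl.2 (Finset.disjoint_right.1 hdisj hi))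
        fun i _ _ => abs_nonneg _
    nlinarith

/-- recovery of the strong-signal set `A₀` by thresholding. -/
theorem statement_13
    (p n : ℕ) (hp : 2 ≤ p) (hn : 1 ≤ n) (β : Fin p → ℝ)
    (hmono : ∀ i j : Fin p, i ≤ j → |β j| ≤ |β i|)
    (σ lam : ℝ) (hσ : 0 < σ) (hlam : lam = Real.sqrt (2 * Real.log p / n))
    (s₀ : ℕ) (hs₀ : 1 ≤ s₀) (h2s₀ : 2 * s₀ ≤ p)
    (hess : EssSparsity β lam σ s₀)
    (T₀ : Finset (Fin p)) (hT₀ : T₀ = Finset.univ.filter fun j : Fin p => (j : ℕ) < s₀)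
    (A₀ : Finset (Fin p)) (hA₀ : A₀ = Finset.univ.filter fun j => lam * σ < |β j|)
    (a₀ : ℕ) (ha₀ : a₀ = A₀.card)
    (βinit h : Fin p → ℝ) (hh : h = βinit - restr β T₀)
    (T₁ : Finset (Fin p)) (hT₁ : TopSetOutside h s₀ T₀ T₁)
    (T₀₁ : Finset (Fin p)) (hT₀₁ : T₀₁ = T₀ ∪ T₁)
    (D₀ D₁ : ℝ) (hD₀pos : 0 < D₀) (hD₁pos : 0 < D₁)
    (hhead : l2 (restr h T₀₁) ≤ D₀ * lam * σ * Real.sqrt s₀)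
    (htail : l1 (restr h T₀ᶜ) ≤ D₁ * lam * σ * s₀)
    (D₀' D₁' : ℝ) (hD₀' : D₀ < D₀') (hD₁' : D₁ < D₁')
    (t₀ : ℝ) (ht₀ : t₀ = min D₀' D₁' * (lam * σ))
    (hbetamin : ∀ j ∈ A₀, D₀ * lam * σ * Real.sqrt s₀ + t₀ ≤ |β j|)
    (I : Finset (Fin p)) (hI : I = Finset.univ.filter fun j => t₀ ≤ |βinit j|)
    (𝒟 : Finset (Fin p)) (h𝒟 : 𝒟 = Iᶜ) :
    A₀ ⊆ I ∧ I ∩ T₀₁ᶜ = ∅ ∧ I.card ≤ 2 * s₀ ∧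
    l2 (restr β 𝒟) ≤ lam * σ * Real.sqrt ((s₀ : ℝ) - a₀) := by
  have hlog : 0 < Real.log p := Real.log_pos (by exact_mod_cast hp)
  have hn' : (0 : ℝ) < n := by exact_mod_cast hn
  have hlampos : 0 < lam := by rw [hlam]; positivity
  have hμ : 0 < lam * σ := mul_pos hlampos hσ
  have hess' : ∑ i, min ((β i) ^ 2) ((lam * σ) ^ 2) ≤ (s₀ : ℝ) * (lam * σ) ^ 2 := by
    rw [mul_pow]
    exact hess.1
  have hmemA : ∀ j, j ∈ A₀ ↔ lam * σ < |β j| := fun j => by simp [hA₀]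
  have hmemI : ∀ j, j ∈ I ↔ t₀ ≤ |βinit j| := fun j => by simp [hI]
  have hsq := sum_sq_compl_le β hμ.le A₀ hmemA hess'
  have ha₀s₀ : A₀.card ≤ s₀ := by
    have h0 : 0 ≤ ((s₀ : ℝ) - A₀.card) * (lam * σ) ^ 2 :=
      (Finset.sum_nonneg fun i _ => sq_nonneg (β i)).trans hsq
    have h1 := nonneg_of_mul_nonneg_left h0 (by positivity)
    exact_mod_cast sub_nonneg.1 h1
  have hA₀T₀ : A₀ ⊆ T₀ := fun j hj => by
    rw [hT₀, Finset.mem_filter]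
    exact ⟨Finset.mem_univ _, (lt_card_of_mem_superlevel β hmono A₀ hmemA hj).trans_le ha₀s₀⟩
  have hA₀I : A₀ ⊆ I := fun j hj => by
    have hjT := hA₀T₀ hj
    have hhj : h j = βinit j - β j := by simp [hh, restr, hjT]
    have hjle : |h j| ≤ D₀ * lam * σ * Real.sqrt s₀ := by
      refine abs_le_of_sq_le_sq (le_trans ?_ (sum_sq_le_of_l2_restr_le h _ hhead)) (by positivity)
      exact Finset.single_le_sum (f := fun i => (h i) ^ 2) (fun i _ => sq_nonneg _)
        (hT₀₁ ▸ Finset.mem_union_left _ hjT)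
    rw [hmemI]
    have := abs_sub_abs_le_abs_sub (β j) (βinit j)
    rw [abs_sub_comm, ← hhj] at this
    linarith [hbetamin j hj]
  have hIT : I ⊆ T₀₁ := fun j hj => by
    by_contra hjT
    rw [hT₀₁] at hjT hhead
    have hhj : h j = βinit j := by simp [hh, restr, (Finset.notMem_union.1 hjT).1]
    obtain ⟨h1, h2⟩ := hT₁.abs_le hs₀ (by positivity) hhead htail hjT
    have hI' := (hmemI j).1 hj
    rw [← hhj, ht₀] at hI'
    rcases min_choice D₀' D₁' with hmin | hmin <;> rw [hmin] at hI' <;> nlinarith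
  refine ⟨hA₀I, ?_, ?_, ?_⟩
  · rw [← Finset.sdiff_eq_inter_compl, Finset.sdiff_eq_empty_iff_subset]
    exact hIT
  · have hT₀card : T₀.card ≤ s₀ := by
      rw [hT₀, Fin.card_filter_val_lt]
      exact min_le_right _ _
    have h1 := Finset.card_le_card hIT
    rw [hT₀₁] at h1
    have h2 := Finset.card_union_le T₀ T₁
    have h3 := hT₁.1
    omega
  · rw [l2_restr, ha₀]
    refine Real.sqrt_le_iff.2 ⟨by positivity, ?_⟩
    rw [mul_pow, Real.sq_sqrt (sub_nonneg.2 (by exact_mod_cast ha₀s₀)), mul_comm]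
    refine le_trans ?_ hsq
    rw [h𝒟]
    exact Finset.sum_le_sum_of_subset_of_nonneg (Finset.compl_subset_compl.2 hA₀I)
      fun i _ _ => sq_nonneg _

end ThreshLasso
end
end

section
/- Let X be an n×p real matrix, β ∈ ℝ^p, ε ∈ ℝⁿ, and Y = Xβ + ε. Let β_init be a Lasso minimizer with penalty λ_n > 0, and suppose ‖Xᵀε/n‖_∞ ≤ λ_n/2. Then for every subset T₀ ⊆ {1,…,p}, writing β₀ = β_{T₀}, h = β_init − β₀ and δ = β_init − β, one has ‖Xδ‖₂²/n + ‖Xh‖₂²/n + λ_n·‖h_{T₀^c}‖₁ ≤ ‖X(β − β₀)‖₂²/n + 3λ_n·‖h_{T₀}‖₁. -/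
open Finset Matrix Real
open scoped BigOperators Classical

noncomputable section

namespace ThreshLasso

lemma l2_sq {m : ℕ} (v : Fin m → ℝ) : (l2 v) ^ 2 = ∑ i, (v i) ^ 2 :=
  Real.sq_sqrt (Finset.sum_nonneg fun _ _ => sq_nonneg _)

lemma nonneg_of_forall_quadratic_nonneg {a c : ℝ} (ha : 0 ≤ a)
    (h : ∀ t : ℝ, 0 < t → t ≤ 1 → 0 ≤ t ^ 2 * a + t * c) : 0 ≤ c := by
  by_contra! hc
  have hd : 0 < 2 * a - c := by linarith
  have ht : 0 < -c / (2 * a - c) := div_pos (by linarith) hd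
  have key := h _ ht ((div_le_one hd).2 (by linarith))
  have e : (-c / (2 * a - c)) * (2 * a - c) = -c := div_mul_cancel₀ _ hd.ne'
  generalize -c / (2 * a - c) = t at *
  have h1 : 0 ≤ t * a + c := by
    by_contra! h2
    nlinarith [mul_pos_of_neg_of_neg h2 (neg_neg_of_pos ht)]
  nlinarith

/-- First-order optimality of a Lasso minimizer towards a competitor. -/
lemma IsLassoSol.first_order {n p : ℕ} {X : Matrix (Fin n) (Fin p) ℝ} {Y : Fin n → ℝ}
    {lamn : ℝ} (hlamn : 0 ≤ lamn) {b : Fin p → ℝ} (hb : IsLassoSol X Y lamn b)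
    (b' : Fin p → ℝ) :
    0 ≤ (1 / n : ℝ) * ∑ i, (Y - X.mulVec b) i * X.mulVec (b - b') i +
      lamn * (l1 b' - l1 b) := by
  refine nonneg_of_forall_quadratic_nonneg
    (a := 1 / (2 * n) * ∑ i, (X.mulVec (b - b') i) ^ 2)
    (mul_nonneg (by positivity) (Finset.sum_nonneg fun _ _ => sq_nonneg _)) ?_
  intro t ht ht1
  have hmin := hb (b - t • (b - b'))
  have hnorm : l1 (b - t • (b - b')) ≤ (1 - t) * l1 b + t * l1 b' := by
    unfold l1
    rw [Finset.mul_sum, Finset.mul_sum, ← Finset.sum_add_distrib]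
    refine Finset.sum_le_sum fun j _ => ?_
    have e : (b - t • (b - b')) j = (1 - t) * b j + t * b' j := by
      simp only [Pi.sub_apply, Pi.smul_apply, smul_eq_mul]; ring
    rw [e]
    refine (abs_add_le _ _).trans_eq ?_
    rw [abs_mul, abs_mul, abs_of_nonneg (sub_nonneg.2 ht1), abs_of_pos ht]
  have hquad : (l2 (Y - X.mulVec (b - t • (b - b')))) ^ 2 = (l2 (Y - X.mulVec b)) ^ 2 +
      2 * t * ∑ i, (Y - X.mulVec b) i * X.mulVec (b - b') i +
      t ^ 2 * ∑ i, (X.mulVec (b - b') i) ^ 2 := by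
    rw [l2_sq, l2_sq, Finset.mul_sum, Finset.mul_sum, ← Finset.sum_add_distrib,
      ← Finset.sum_add_distrib]
    refine Finset.sum_congr rfl fun i _ => ?_
    rw [Matrix.mulVec_sub X b (t • (b - b')), Matrix.mulVec_smul]
    simp only [Pi.sub_apply, Pi.smul_apply, smul_eq_mul]
    ring
  rw [hquad] at hmin
  have hpen := mul_le_mul_of_nonneg_left hnorm hlamn
  have e : (1 / (2 * n) : ℝ) = 1 / n / 2 := by rw [div_div, mul_comm]
  rw [e] at hmin ⊢
  linarith

/-- Hölder's inequality for the noise term. -/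
lemma noise_le {n p : ℕ} {X : Matrix (Fin n) (Fin p) ℝ} {ε : Fin n → ℝ} {c : ℝ}
    (hnoise : ∀ j, |(∑ i, X i j * ε i) / n| ≤ c) (v : Fin p → ℝ) :
    (1 / n : ℝ) * ∑ i, ε i * X.mulVec v i ≤ c * l1 v := by
  have e : (1 / n : ℝ) * ∑ i, ε i * X.mulVec v i = ∑ j, (∑ i, X i j * ε i) / n * v j := by
    simp only [Matrix.mulVec, dotProduct, Finset.mul_sum, Finset.sum_div, Finset.sum_mul]
    rw [Finset.sum_comm]
    exact Finset.sum_congr rfl fun _ _ => Finset.sum_congr rfl fun _ _ => by ring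
  rw [e, l1, Finset.mul_sum]
  refine Finset.sum_le_sum fun j _ => (le_abs_self _).trans ?_
  rw [abs_mul]
  exact mul_le_mul_of_nonneg_right (hnoise j) (abs_nonneg _)

lemma l1_restr_add_compl {p : ℕ} (v : Fin p → ℝ) (T : Finset (Fin p)) :
    l1 (restr v T) + l1 (restr v Tᶜ) = l1 v := by
  unfold l1 restr
  rw [← Finset.sum_add_distrib]
  refine Finset.sum_congr rfl fun j _ => ?_
  by_cases hj : j ∈ T <;> simp [hj]

lemma l1_restr_sub_le {p : ℕ} (u b : Fin p → ℝ) (T : Finset (Fin p)) :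
    l1 (restr u T) - l1 b ≤
      l1 (restr (b - restr u T) T) - l1 (restr (b - restr u T) Tᶜ) := by
  unfold l1 restr
  rw [← Finset.sum_sub_distrib, ← Finset.sum_sub_distrib]
  refine Finset.sum_le_sum fun j _ => ?_
  by_cases hj : j ∈ T
  · simpa [hj, abs_sub_comm] using abs_sub_abs_le_abs_sub (u j) (b j)
  · simp [hj]

/-- basic oracle inequality for the Lasso on the noise event. -/
theorem statement_15
    (n p : ℕ) (hn : 0 < n)
    (X : Matrix (Fin n) (Fin p) ℝ) (β : Fin p → ℝ) (ε Y : Fin n → ℝ)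
    (hY : Y = X.mulVec β + ε)
    (lamn : ℝ) (hlamn : 0 < lamn)
    (βinit : Fin p → ℝ) (hinit : IsLassoSol X Y lamn βinit)
    (hnoise : ∀ j, |(∑ i, X i j * ε i) / n| ≤ lamn / 2)
    (T₀ : Finset (Fin p))
    (β₀ h δ : Fin p → ℝ) (hβ₀ : β₀ = restr β T₀)
    (hh : h = βinit - β₀) (hδ : δ = βinit - β) :
    (l2 (X.mulVec δ)) ^ 2 / n + (l2 (X.mulVec h)) ^ 2 / n + lamn * l1 (restr h T₀ᶜ) ≤
      (l2 (X.mulVec (β - β₀))) ^ 2 / n + 3 * lamn * l1 (restr h T₀) := by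
  have hopt := hinit.first_order hlamn.le β₀
  have hnz := noise_le hnoise h
  have hsplit := l1_restr_add_compl h T₀
  have hcone : l1 β₀ - l1 βinit ≤ l1 (restr h T₀) - l1 (restr h T₀ᶜ) := by
    subst hh hβ₀
    exact l1_restr_sub_le β βinit T₀
  have hpen := mul_le_mul_of_nonneg_left hcone hlamn.le
  have hpol : 2 * ∑ i, (Y - X.mulVec βinit) i * X.mulVec h i =
      2 * ∑ i, ε i * X.mulVec h i - (l2 (X.mulVec δ)) ^ 2 - (l2 (X.mulVec h)) ^ 2 +
        (l2 (X.mulVec (β - β₀))) ^ 2 := by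
    simp only [l2_sq, Finset.mul_sum]
    rw [← Finset.sum_sub_distrib, ← Finset.sum_sub_distrib, ← Finset.sum_add_distrib]
    refine Finset.sum_congr rfl fun i _ => ?_
    simp only [hY, hh, hδ, Matrix.mulVec_sub, Pi.sub_apply, Pi.add_apply]
    ring
  rw [← hh] at hopt
  have hscaled := congrArg (fun x : ℝ => 1 / n * x) hpol
  simp only [div_eq_mul_inv, one_mul] at *
  rw [← hsplit] at hnz
  linarith

end ThreshLasso
end
end
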